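/- arXiv:2407.18082 — 5 statements merged into one kernel-verified Lean document; each statement's English description precedes it below -/
import Mathlib

section
/- Let I ⊆ ℝ be a nonempty open interval that is either bounded or a half-line, and let ρ0 > 0. Then there exists a constant C > 0, depending only on I and ρ0, such that for every measurable function f : I → ℝ that is integrable on every bounded measurable subset of I, one has C⁻¹ |f|_{Ḣ^{1/2}_1(I)} ≤ |f|_{Ḣ^{1/2}_{ρ0}(I)} ≤ C |f|_{Ḣ^{1/2}_1(I)}, where both sides are allowed to be +∞ simultaneously. -/
open MeasureTheory Set Filter
open scoped ENNReal BigOperators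

noncomputable def screenedSeminorm (I : Set ℝ) (r : ℝ) (f : ℝ → ℝ) : ℝ≥0∞ :=
  (∫⁻ x in I, ∫⁻ y in I ∩ Set.Ioo (x - r) (x + r),
      ENNReal.ofReal ((f y - f x) ^ 2 / (y - x) ^ 2)) ^ (1 / 2 : ℝ)

def LocIntOn (I : Set ℝ) (f : ℝ → ℝ) : Prop :=
  ∀ s : Set ℝ, s ⊆ I → MeasurableSet s → Bornology.IsBounded s →
    MeasureTheory.IntegrableOn f s

noncomputable def avgOn (J : Set ℝ) (f : ℝ → ℝ) : ℝ :=
  (MeasureTheory.volume J).toReal⁻¹ * ∫ x in J, f x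

/-- The integrand of the screened seminorm, extended by zero to all of `ℝ × ℝ`. -/
noncomputable def screenedKernel (I : Set ℝ) (r : ℝ) (f : ℝ → ℝ) (p : ℝ × ℝ) : ℝ≥0∞ :=
  {p : ℝ × ℝ | p.1 ∈ I ∧ p.2 ∈ I ∧ |p.2 - p.1| < r}.indicator
    (fun p => ENNReal.ofReal ((f p.2 - f p.1) ^ 2 / (p.2 - p.1) ^ 2)) p

theorem screenedKernel_of_mem {I : Set ℝ} {r : ℝ} (f : ℝ → ℝ) {x y : ℝ} (hx : x ∈ I) (hy : y ∈ I)
    (h : |y - x| < r) :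
    screenedKernel I r f (x, y) = ENNReal.ofReal ((f y - f x) ^ 2 / (y - x) ^ 2) :=
  indicator_of_mem (show (x, y) ∈ {p : ℝ × ℝ | p.1 ∈ I ∧ p.2 ∈ I ∧ |p.2 - p.1| < r} from
    ⟨hx, hy, h⟩) _

theorem screenedKernel_of_notMem {I : Set ℝ} {r : ℝ} (f : ℝ → ℝ) {x y : ℝ}
    (h : ¬(x ∈ I ∧ y ∈ I ∧ |y - x| < r)) : screenedKernel I r f (x, y) = 0 :=
  indicator_of_notMem (s := {p : ℝ × ℝ | p.1 ∈ I ∧ p.2 ∈ I ∧ |p.2 - p.1| < r}) h _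

theorem measurable_screenedKernel {I : Set ℝ} (hI : MeasurableSet I) (r : ℝ) {f : ℝ → ℝ}
    (hf : Measurable f) : Measurable (screenedKernel I r f) := by
  refine Measurable.indicator (by fun_prop) ?_
  have h : MeasurableSet {p : ℝ × ℝ | |p.2 - p.1| < r} :=
    measurableSet_lt (by fun_prop) measurable_const
  exact (measurable_fst hI).inter ((measurable_snd hI).inter h)

theorem screenedSeminorm_eq_lintegral_screenedKernel {I : Set ℝ} (hI : MeasurableSet I) (r : ℝ)
    (f : ℝ → ℝ) :
    screenedSeminorm I r f = (∫⁻ x, ∫⁻ y, screenedKernel I r f (x, y)) ^ (1 / 2 : ℝ) := by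
  unfold screenedSeminorm
  congr 1
  rw [← lintegral_indicator hI]
  refine lintegral_congr fun x => ?_
  by_cases hx : x ∈ I
  · rw [indicator_of_mem hx, ← lintegral_indicator (hI.inter measurableSet_Ioo)]
    refine lintegral_congr fun y => ?_
    by_cases hy : y ∈ I ∩ Ioo (x - r) (x + r)
    · rw [indicator_of_mem hy, screenedKernel_of_mem f hx hy.1]
      rw [abs_lt]
      exact ⟨by linarith [hy.2.1], by linarith [hy.2.2]⟩
    · rw [indicator_of_notMem hy, screenedKernel_of_notMem]
      rintro ⟨-, hyI, h⟩
      rw [abs_lt] at h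
      exact hy ⟨hyI, by linarith, by linarith⟩
  · rw [indicator_of_notMem hx]
    simp [screenedKernel_of_notMem f (fun h => hx h.1)]

theorem screenedSeminorm_congr_ae {I : Set ℝ} (r : ℝ) {f g : ℝ → ℝ}
    (h : f =ᵐ[volume.restrict I] g) : screenedSeminorm I r f = screenedSeminorm I r g := by
  unfold screenedSeminorm
  congr 1
  refine lintegral_congr_ae (h.mono fun x hx => lintegral_congr_ae ?_)
  filter_upwards [ae_restrict_of_ae_restrict_of_subset inter_subset_left h] with y hy
  rw [hx, hy]

theorem screenedSeminorm_mono_radius {I : Set ℝ} {r s : ℝ} (hrs : r ≤ s) (f : ℝ → ℝ) :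
    screenedSeminorm I r f ≤ screenedSeminorm I s f := by
  unfold screenedSeminorm
  gcongr

theorem sq_sub_div_sq_le_midpoint (a b c x y : ℝ) :
    (b - a) ^ 2 / (y - x) ^ 2 ≤ 1 / 2 *
      ((c - a) ^ 2 / ((x + y) / 2 - x) ^ 2 + (c - b) ^ 2 / ((y + x) / 2 - y) ^ 2) := by
  have e1 : ((x + y) / 2 - x) ^ 2 = (y - x) ^ 2 / 4 := by ring
  have e2 : ((y + x) / 2 - y) ^ 2 = (y - x) ^ 2 / 4 := by ring
  have e3 : 1 / 2 * ((c - a) ^ 2 / ((y - x) ^ 2 / 4) + (c - b) ^ 2 / ((y - x) ^ 2 / 4)) =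
      (2 * (c - a) ^ 2 + 2 * (c - b) ^ 2) / (y - x) ^ 2 := by
    simp only [div_eq_mul_inv, mul_inv, inv_inv]
    ring
  rw [e1, e2, e3]
  gcongr
  nlinarith [sq_nonneg ((c - a) + (c - b))]

/-- Splitting an increment at the midpoint halves the screening radius. -/
theorem screenedKernel_two_mul_le {I : Set ℝ} (hI : Convex ℝ I) (r : ℝ) (f : ℝ → ℝ) (x y : ℝ) :
    screenedKernel I (2 * r) f (x, y) ≤ ENNReal.ofReal (1 / 2) *
      (screenedKernel I r f (x, (x + y) / 2) + screenedKernel I r f (y, (y + x) / 2)) := by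
  by_cases h : x ∈ I ∧ y ∈ I ∧ |y - x| < 2 * r
  · obtain ⟨hx, hy, hxy⟩ := h
    have hm : (x + y) / 2 ∈ I := by
      have := hI hx hy (by norm_num : (0 : ℝ) ≤ 1 / 2) (by norm_num : (0 : ℝ) ≤ 1 / 2)
        (by norm_num)
      simp only [smul_eq_mul] at this
      convert this using 1
      ring
    have hm' : (y + x) / 2 ∈ I := by rwa [add_comm]
    rw [abs_lt] at hxy
    rw [screenedKernel_of_mem f hx hy (abs_lt.2 hxy),
      screenedKernel_of_mem f hx hm (abs_lt.2 ⟨by linarith, by linarith⟩),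
      screenedKernel_of_mem f hy hm' (abs_lt.2 ⟨by linarith, by linarith⟩),
      ← ENNReal.ofReal_add (by positivity) (by positivity), ← ENNReal.ofReal_mul (by norm_num)]
    refine ENNReal.ofReal_le_ofReal ?_
    rw [show f ((y + x) / 2) = f ((x + y) / 2) by rw [add_comm]]
    exact sq_sub_div_sq_le_midpoint _ _ _ _ _
  · rw [screenedKernel_of_notMem f h]
    exact zero_le

theorem lintegral_comp_midpoint {h : ℝ → ℝ≥0∞} (hh : Measurable h) (x : ℝ) :
    ∫⁻ y, h ((x + y) / 2) = 2 * ∫⁻ y, h y := by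
  have h2 : (2⁻¹ : ℝ) ≠ 0 := by norm_num
  calc ∫⁻ y, h ((x + y) / 2) = ∫⁻ y, h (y / 2) :=
        lintegral_add_left_eq_self (fun y => h (y / 2)) x
    _ = ∫⁻ y, h y ∂(Measure.map (· * (2⁻¹ : ℝ)) volume) := by
        rw [lintegral_map hh (by fun_prop)]
        simp only [div_eq_mul_inv]
    _ = 2 * ∫⁻ y, h y := by
        rw [Real.map_volume_mul_right h2, lintegral_smul_measure]
        norm_num

theorem lintegral_screenedKernel_two_mul_le {I : Set ℝ} (hI : Convex ℝ I) (hIm : MeasurableSet I)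
    (r : ℝ) {f : ℝ → ℝ} (hf : Measurable f) :
    ∫⁻ x, ∫⁻ y, screenedKernel I (2 * r) f (x, y) ≤
      2 * ∫⁻ x, ∫⁻ y, screenedKernel I r f (x, y) := by
  have hk := measurable_screenedKernel hIm r hf
  have hmid : ∫⁻ x, ∫⁻ y, screenedKernel I r f (x, (x + y) / 2) =
      2 * ∫⁻ x, ∫⁻ y, screenedKernel I r f (x, y) := by
    rw [← lintegral_const_mul _ hk.lintegral_prod_right']
    exact lintegral_congr fun x =>
      lintegral_comp_midpoint (h := fun y => screenedKernel I r f (x, y)) (by fun_prop) x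
  have hk1 : Measurable fun p : ℝ × ℝ => screenedKernel I r f (p.1, (p.1 + p.2) / 2) := by
    fun_prop
  have hk2 : Measurable fun p : ℝ × ℝ => screenedKernel I r f (p.2, (p.2 + p.1) / 2) := by
    fun_prop
  calc ∫⁻ x, ∫⁻ y, screenedKernel I (2 * r) f (x, y)
      ≤ ∫⁻ x, ∫⁻ y, ENNReal.ofReal (1 / 2) * (screenedKernel I r f (x, (x + y) / 2) +
          screenedKernel I r f (y, (y + x) / 2)) :=
        lintegral_mono fun x => lintegral_mono fun y => screenedKernel_two_mul_le hI r f x y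
    _ = ENNReal.ofReal (1 / 2) * ((∫⁻ x, ∫⁻ y, screenedKernel I r f (x, (x + y) / 2)) +
          ∫⁻ x, ∫⁻ y, screenedKernel I r f (y, (y + x) / 2)) := by
        rw [← lintegral_add_left hk1.lintegral_prod_right',
          ← lintegral_const_mul' _ _ ENNReal.ofReal_ne_top]
        refine lintegral_congr fun x => ?_
        rw [lintegral_const_mul' _ _ ENNReal.ofReal_ne_top, lintegral_add_left (by fun_prop)]
    _ = 2 * ∫⁻ x, ∫⁻ y, screenedKernel I r f (x, y) := by
        rw [lintegral_lintegral_swap (f := fun x y => screenedKernel I r f (y, (y + x) / 2))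
          hk2.aemeasurable, hmid, ← two_mul, ← mul_assoc]
        have : ENNReal.ofReal (1 / 2) * 2 = 1 := by
          rw [← ENNReal.ofReal_ofNat, ← ENNReal.ofReal_mul (by norm_num)]
          norm_num
        rw [this, one_mul]

theorem screenedSeminorm_two_mul_le {I : Set ℝ} (hI : Convex ℝ I) (hIm : MeasurableSet I)
    (r : ℝ) {f : ℝ → ℝ} (hf : AEMeasurable f (volume.restrict I)) :
    screenedSeminorm I (2 * r) f ≤ 2 * screenedSeminorm I r f := by
  obtain ⟨g, hg, hfg⟩ := hf
  rw [screenedSeminorm_congr_ae _ hfg, screenedSeminorm_congr_ae _ hfg,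
    screenedSeminorm_eq_lintegral_screenedKernel hIm,
    screenedSeminorm_eq_lintegral_screenedKernel hIm]
  calc _ ≤ (2 * ∫⁻ x, ∫⁻ y, screenedKernel I r g (x, y)) ^ (1 / 2 : ℝ) := by
        gcongr
        exact lintegral_screenedKernel_two_mul_le hI hIm r hg
    _ = 2 ^ (1 / 2 : ℝ) * (∫⁻ x, ∫⁻ y, screenedKernel I r g (x, y)) ^ (1 / 2 : ℝ) :=
        ENNReal.mul_rpow_of_nonneg _ _ (by norm_num)
    _ ≤ _ := by
        gcongr
        exact (ENNReal.rpow_le_rpow_of_exponent_le one_le_two (by norm_num)).trans_eq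
          (ENNReal.rpow_one 2)

theorem screenedSeminorm_two_pow_mul_le {I : Set ℝ} (hI : Convex ℝ I) (hIm : MeasurableSet I)
    (r : ℝ) {f : ℝ → ℝ} (hf : AEMeasurable f (volume.restrict I)) (n : ℕ) :
    screenedSeminorm I (2 ^ n * r) f ≤ 2 ^ n * screenedSeminorm I r f := by
  induction n with
  | zero => simp
  | succ n ih =>
    calc screenedSeminorm I (2 ^ (n + 1) * r) f
        = screenedSeminorm I (2 * (2 ^ n * r)) f := by rw [pow_succ', mul_assoc]
      _ ≤ 2 * screenedSeminorm I (2 ^ n * r) f := screenedSeminorm_two_mul_le hI hIm _ hf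
      _ ≤ 2 * (2 ^ n * screenedSeminorm I r f) := by gcongr
      _ = 2 ^ (n + 1) * screenedSeminorm I r f := by rw [pow_succ', mul_assoc]

theorem LocIntOn.aemeasurable {I : Set ℝ} (hI : MeasurableSet I) {f : ℝ → ℝ}
    (hf : LocIntOn I f) : AEMeasurable f (volume.restrict I) := by
  have hU : I = ⋃ n : ℕ, I ∩ Metric.closedBall 0 n := by
    rw [← inter_iUnion, Metric.iUnion_closedBall_nat, inter_univ]
  rw [hU]
  exact AEMeasurable.iUnion fun n => (hf _ inter_subset_left
    (hI.inter Metric.isClosed_closedBall.measurableSet)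
    (Metric.isBounded_closedBall.subset inter_subset_right)).aestronglyMeasurable.aemeasurable

/-- On a nonempty open interval `I` that is either bounded or a half-line,
for any screening radius `ρ0 > 0` the screened seminorms with radii `1` and `ρ0` are
uniformly equivalent: there is `C > 0` (depending only on `I` and `ρ0`) with
`C⁻¹ |f|_{Ḣ^{1/2}_1(I)} ≤ |f|_{Ḣ^{1/2}_{ρ0}(I)} ≤ C |f|_{Ḣ^{1/2}_1(I)}` for every
locally integrable `f`, both sides being allowed to be `+∞` simultaneously. -/
theorem statement0 (I : Set ℝ)
    (hI : (∃ a b : ℝ, a < b ∧ I = Set.Ioo a b) ∨ (∃ a : ℝ, I = Set.Ioi a) ∨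
      (∃ a : ℝ, I = Set.Iio a))
    (ρ0 : ℝ) (hρ0 : 0 < ρ0) :
    ∃ C : ℝ, 0 < C ∧ ∀ f : ℝ → ℝ, LocIntOn I f →
      ENNReal.ofReal C⁻¹ * screenedSeminorm I 1 f ≤ screenedSeminorm I ρ0 f ∧
      screenedSeminorm I ρ0 f ≤ ENNReal.ofReal C * screenedSeminorm I 1 f := by
  have hconv : Convex ℝ I := by
    rcases hI with ⟨a, b, -, rfl⟩ | ⟨a, rfl⟩ | ⟨a, rfl⟩
    exacts [convex_Ioo a b, convex_Ioi a, convex_Iio a]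
  have hIm : MeasurableSet I := hconv.ordConnected.measurableSet
  obtain ⟨n, hn⟩ := pow_unbounded_of_one_lt (max ρ0 ρ0⁻¹) (one_lt_two : (1 : ℝ) < 2)
  have h1 : ρ0 ≤ 2 ^ n * 1 := by
    rw [mul_one]
    exact (le_max_left _ _).trans hn.le
  have h2 : 1 ≤ 2 ^ n * ρ0 := by
    rw [← inv_mul_cancel₀ hρ0.ne']
    gcongr
    exact (le_max_right _ _).trans hn.le
  have hpow : ENNReal.ofReal (2 ^ n) = 2 ^ n := by
    rw [ENNReal.ofReal_pow zero_le_two, ENNReal.ofReal_ofNat]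
  refine ⟨2 ^ n, by positivity, fun f hf => ?_⟩
  have hfm := hf.aemeasurable hIm
  rw [ENNReal.ofReal_inv_of_pos (by positivity), hpow]
  constructor
  · rw [ENNReal.inv_mul_le_iff (by simp) (by simp)]
    exact (screenedSeminorm_mono_radius h2 f).trans
      (screenedSeminorm_two_pow_mul_le hconv hIm ρ0 hfm n)
  · exact (screenedSeminorm_mono_radius h1 f).trans
      (screenedSeminorm_two_pow_mul_le hconv hIm 1 hfm n)
end

section
/- Let E ⊆ ℝ be an interval, let I₁, I₂ ⊆ E be bounded subintervals of positive length, and set ρ0 := sup{ |y − x| : x ∈ I₁, y ∈ I₂ }. Then for every measurable function f : E → ℝ that is integrable on every bounded measurable subset of E, one has | avg_{I₁} f − avg_{I₂} f | ≤ ( ρ0 / √(|I₁| · |I₂|) ) · |f|_{Ḣ^{1/2}_{ρ0}(E)}. -/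
open MeasureTheory Set Filter
open scoped ENNReal BigOperators

/-- Two points of open intervals are at distance less than the supremum of such distances. -/
lemma abs_sub_lt_of_isLUB {a₁ b₁ a₂ b₂ r x y : ℝ}
    (hr : IsLUB {d : ℝ | ∃ x ∈ Set.Ioo a₁ b₁, ∃ y ∈ Set.Ioo a₂ b₂, d = |y - x|} r)
    (hx : x ∈ Set.Ioo a₁ b₁) (hy : y ∈ Set.Ioo a₂ b₂) : |y - x| < r := by
  obtain ⟨u, hu, hub⟩ := exists_between hy.2
  obtain ⟨v, hv, hvy⟩ := exists_between hy.1
  have h1 : |u - x| ≤ r := hr.1 ⟨x, hx, u, ⟨hy.1.trans hu, hub⟩, rfl⟩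
  have h2 : |v - x| ≤ r := hr.1 ⟨x, hx, v, ⟨hv, hvy.trans hy.2⟩, rfl⟩
  rw [abs_le] at h1 h2
  rw [abs_lt]
  constructor <;> linarith

lemma sq_le_sq_mul_sq_div_sq {r d z : ℝ} (hz : z = 0 → d = 0) (hzr : |z| ≤ r) :
    d ^ 2 ≤ r ^ 2 * (d ^ 2 / z ^ 2) := by
  rcases eq_or_ne z 0 with h | h
  · simp [hz h]
  · have h0 : 0 < z ^ 2 := by positivity
    have h1 : z ^ 2 ≤ r ^ 2 := sq_le_sq' (by linarith [(abs_le.1 hzr).1]) (abs_le.1 hzr).2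
    rw [← mul_div_assoc, le_div_iff₀ h0, mul_comm]
    gcongr

/-- The double integral of squared differences over two sets at mutual distance less than `r`
is controlled by the screened seminorm. -/
lemma lintegral_lintegral_sq_sub_le_screenedSeminorm {E s t : Set ℝ} {r : ℝ} (f : ℝ → ℝ)
    (hs : MeasurableSet s) (ht : MeasurableSet t) (hsE : s ⊆ E) (htE : t ⊆ E)
    (hr : ∀ x ∈ s, ∀ y ∈ t, |y - x| < r) :
    ∫⁻ x in s, ∫⁻ y in t, ENNReal.ofReal ((f y - f x) ^ 2) ≤
      ENNReal.ofReal (r ^ 2) * screenedSeminorm E r f ^ (2 : ℝ) := by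
  rw [screenedSeminorm, ← ENNReal.rpow_mul]
  norm_num only [ENNReal.rpow_one]
  rw [← lintegral_const_mul' _ _ ENNReal.ofReal_ne_top]
  refine le_trans (setLIntegral_mono' hs fun x hx => ?_) (lintegral_mono_set hsE)
  rw [← lintegral_const_mul' _ _ ENNReal.ofReal_ne_top]
  refine le_trans (setLIntegral_mono' ht fun y hy => ?_) (lintegral_mono_set fun y hy => ?_)
  · rw [← ENNReal.ofReal_mul (sq_nonneg r)]
    refine ENNReal.ofReal_le_ofReal (sq_le_sq_mul_sq_div_sq (fun h => ?_) (hr x hx y hy).le)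
    rw [sub_eq_zero.1 h, sub_self]
  · have h := abs_lt.1 (hr x hx y hy)
    exact ⟨htE hy, by linarith [h.1], by linarith [h.2]⟩

/-- Cauchy–Schwarz for the integral of a difference over a product of finite measures. -/
lemma enorm_integral_prod_sub_le {μ ν : Measure ℝ} [IsFiniteMeasure μ] [IsFiniteMeasure ν]
    {f : ℝ → ℝ} (hμ : Integrable f μ) (hν : Integrable f ν) :
    ‖μ.real univ * ∫ y, f y ∂ν - ν.real univ * ∫ x, f x ∂μ‖ₑ ≤
      (∫⁻ x, ∫⁻ y, ENNReal.ofReal ((f y - f x) ^ 2) ∂ν ∂μ) ^ (1 / 2 : ℝ) *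
        (μ univ * ν univ) ^ (1 / 2 : ℝ) := by
  have h1 : Integrable (fun z : ℝ × ℝ => f z.1) (μ.prod ν) := hμ.comp_fst ν
  have h2 : Integrable (fun z : ℝ × ℝ => f z.2) (μ.prod ν) := hν.comp_snd μ
  have hm : AEStronglyMeasurable (fun z : ℝ × ℝ => f z.2 - f z.1) (μ.prod ν) :=
    (h2.sub h1).aestronglyMeasurable
  have hint : ∫ z : ℝ × ℝ, (f z.2 - f z.1) ∂(μ.prod ν) =
      μ.real univ * ∫ y, f y ∂ν - ν.real univ * ∫ x, f x ∂μ := by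
    rw [integral_sub h2 h1, integral_fun_snd, integral_fun_fst, smul_eq_mul, smul_eq_mul]
  have hCS := eLpNorm_le_eLpNorm_mul_rpow_measure_univ (p := 1) (q := 2) (by norm_num) hm
  rw [eLpNorm_one_eq_lintegral_enorm,
    eLpNorm_eq_lintegral_rpow_enorm_toReal (by norm_num) (by norm_num)] at hCS
  have hsq : ∀ z : ℝ × ℝ,
      ‖f z.2 - f z.1‖ₑ ^ (2 : ℝ) = ENNReal.ofReal ((f z.2 - f z.1) ^ 2) := fun z => by
    rw [Real.enorm_eq_ofReal_abs, ENNReal.ofReal_rpow_of_nonneg (abs_nonneg _) (by norm_num),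
      Real.rpow_two, sq_abs]
  have hprod := lintegral_prod (fun z : ℝ × ℝ => ENNReal.ofReal ((f z.2 - f z.1) ^ 2))
    (hm.aemeasurable.pow_const 2).ennreal_ofReal
  rw [← hint, ← Measure.prod_prod, univ_prod_univ, ← hprod]
  refine (enorm_integral_le_lintegral_enorm _).trans (hCS.trans_eq ?_)
  simp only [ENNReal.toReal_ofNat, ENNReal.toReal_one, hsq]
  norm_num

/-- if `I₁, I₂` are bounded subintervals (of positive length) of an interval
`E` and `ρ0 = sup{|y − x| : x ∈ I₁, y ∈ I₂}`, then for every locally integrable `f` on `E`,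
`|avg_{I₁} f − avg_{I₂} f| ≤ (ρ0 / √(|I₁|·|I₂|)) |f|_{Ḣ^{1/2}_{ρ0}(E)}`. -/
theorem statement3 (E : Set ℝ) (hE : E.OrdConnected)
    (a₁ b₁ a₂ b₂ : ℝ) (h₁ : a₁ < b₁) (h₂ : a₂ < b₂)
    (hI₁ : Set.Ioo a₁ b₁ ⊆ E) (hI₂ : Set.Ioo a₂ b₂ ⊆ E)
    (ρ0 : ℝ)
    (hρ0 : IsLUB {d : ℝ | ∃ x ∈ Set.Ioo a₁ b₁, ∃ y ∈ Set.Ioo a₂ b₂, d = |y - x|} ρ0)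
    (f : ℝ → ℝ) (hf : LocIntOn E f) :
    ENNReal.ofReal |avgOn (Set.Ioo a₁ b₁) f - avgOn (Set.Ioo a₂ b₂) f| ≤
      ENNReal.ofReal (ρ0 / Real.sqrt ((b₁ - a₁) * (b₂ - a₂))) * screenedSeminorm E ρ0 f := by
  have hf₁ : IntegrableOn f (Ioo a₁ b₁) := hf _ hI₁ measurableSet_Ioo (Metric.isBounded_Ioo _ _)
  have hf₂ : IntegrableOn f (Ioo a₂ b₂) := hf _ hI₂ measurableSet_Ioo (Metric.isBounded_Ioo _ _)
  have hL₁ : 0 < b₁ - a₁ := sub_pos.2 h₁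
  have hL₂ : 0 < b₂ - a₂ := sub_pos.2 h₂
  have hdist : ∀ x ∈ Ioo a₁ b₁, ∀ y ∈ Ioo a₂ b₂, |y - x| < ρ0 :=
    fun x hx y hy => abs_sub_lt_of_isLUB hρ0 hx hy
  have hρ : 0 ≤ ρ0 := by
    obtain ⟨x, hx⟩ := nonempty_Ioo.2 h₁
    obtain ⟨y, hy⟩ := nonempty_Ioo.2 h₂
    exact (abs_nonneg _).trans (hdist x hx y hy).le
  have hsem := lintegral_lintegral_sq_sub_le_screenedSeminorm f measurableSet_Ioo
    measurableSet_Ioo hI₁ hI₂ hdist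
  have hCS := (enorm_integral_prod_sub_le hf₁ hf₂).trans
    (mul_le_mul_left (ENNReal.rpow_le_rpow hsem (by norm_num : (0 : ℝ) ≤ 1 / 2)) _)
  have hroot : (ENNReal.ofReal (ρ0 ^ 2) * screenedSeminorm E ρ0 f ^ (2 : ℝ)) ^ (1 / 2 : ℝ) =
      ENNReal.ofReal ρ0 * screenedSeminorm E ρ0 f := by
    rw [ENNReal.mul_rpow_of_nonneg _ _ (by norm_num), ← ENNReal.rpow_mul,
      ENNReal.ofReal_rpow_of_nonneg (sq_nonneg _) (by norm_num), ← Real.sqrt_eq_rpow,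
      Real.sqrt_sq hρ]
    norm_num
  simp only [Measure.real, Measure.restrict_apply_univ, Real.volume_Ioo,
    ENNReal.toReal_ofReal hL₁.le, ENNReal.toReal_ofReal hL₂.le] at hCS
  rw [hroot, ← ENNReal.ofReal_mul hL₁.le, ENNReal.ofReal_rpow_of_pos (by positivity),
    ← Real.sqrt_eq_rpow] at hCS
  have havg : |avgOn (Ioo a₁ b₁) f - avgOn (Ioo a₂ b₂) f| =
      ((b₁ - a₁) * (b₂ - a₂))⁻¹ *
        |(b₁ - a₁) * (∫ y in Ioo a₂ b₂, f y) - (b₂ - a₂) * ∫ x in Ioo a₁ b₁, f x| := by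
    rw [← abs_of_pos (inv_pos.2 (mul_pos hL₁ hL₂)), ← abs_mul, abs_sub_comm]
    simp only [avgOn, Real.volume_Ioo, ENNReal.toReal_ofReal hL₁.le, ENNReal.toReal_ofReal hL₂.le]
    congr 1
    field_simp
  rw [havg, ENNReal.ofReal_mul (by positivity), ← Real.enorm_eq_ofReal_abs]
  refine (mul_le_mul_right hCS _).trans_eq ?_
  have hconst : ρ0 / √((b₁ - a₁) * (b₂ - a₂)) =
      ((b₁ - a₁) * (b₂ - a₂))⁻¹ * ρ0 * √((b₁ - a₁) * (b₂ - a₂)) := by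
    have hs : 0 < √((b₁ - a₁) * (b₂ - a₂)) := Real.sqrt_pos.2 (mul_pos hL₁ hL₂)
    rw [div_eq_iff hs.ne', mul_assoc, Real.mul_self_sqrt (mul_pos hL₁ hL₂).le]
    field_simp
  rw [hconst, ENNReal.ofReal_mul (by positivity), ENNReal.ofReal_mul (by positivity)]
  ring
end

section
/- Let a ∈ ℝ, b ∈ (a, +∞], E = (a, b), ρ0 > 0, and for x ∈ E set H⁺(x) := (0, min(ρ0, b − x)). Let c0 > 0 and c1 := c0²/(1 + c0²). Let U ⊆ ℝ² be an open set such that for every x ∈ E and h ∈ H⁺(x), the closed triangle with vertices (x, 0), (x + h, 0) and (x + c1 h, −(c1/c0) h) is contained in U. Then there exists a constant C > 0, depending only on c0, such that every function φ that is continuously differentiable on U with ∫_U |∇φ|² < ∞ satisfies the trace estimate ∫_E ∫_{H⁺(x)} ( φ(x + h, 0) − φ(x, 0) )² / h² dh dx ≤ C ∫_U |∇φ|². -/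
open MeasureTheory Set Filter
open scoped ENNReal BigOperators

theorem sq_lintegral_mul_le {α : Type*} [MeasurableSpace α] {μ : Measure α} {f g : α → ℝ≥0∞}
    (hf : AEMeasurable f μ) (hg : AEMeasurable g μ) :
    (∫⁻ x, f x * g x ∂μ) ^ 2 ≤ (∫⁻ x, f x ^ 2 ∂μ) * ∫⁻ x, g x ^ 2 ∂μ := by
  have h := ENNReal.lintegral_mul_le_Lp_mul_Lq μ (p := 2) (q := 2)
    (by constructor <;> norm_num) hf hg
  simp only [ENNReal.rpow_ofNat, Pi.mul_apply] at h
  refine (pow_le_pow_left' h 2).trans_eq ?_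
  rw [mul_pow, ← ENNReal.rpow_natCast, ← ENNReal.rpow_natCast, ← ENNReal.rpow_mul,
    ← ENNReal.rpow_mul]
  norm_num

theorem lintegral_Ioo_rpow_neg_half {h : ℝ} (hh : 0 < h) :
    ∫⁻ s in Ioo 0 h, ENNReal.ofReal (s ^ (-(1 / 2) : ℝ)) =
      ENNReal.ofReal (2 * h ^ (1 / 2 : ℝ)) := by
  have hi : IntegrableOn (fun s : ℝ => s ^ (-(1 / 2) : ℝ)) (Ioc 0 h) :=
    (intervalIntegrable_iff_integrableOn_Ioc_of_le hh.le).1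
      (intervalIntegral.intervalIntegrable_rpow' (by norm_num))
  rw [restrict_Ioo_eq_restrict_Ioc, ← ofReal_integral_eq_lintegral_ofReal hi
    ((ae_restrict_mem measurableSet_Ioc).mono fun s hs => Real.rpow_nonneg hs.1.le _),
    ← intervalIntegral.integral_of_le hh.le, integral_rpow (Or.inl (by norm_num))]
  congr 1
  norm_num
  ring

theorem lintegral_Ioi_rpow_neg_three_halves {s : ℝ} (hs : 0 < s) :
    ∫⁻ h in Ioi s, ENNReal.ofReal (h ^ (-(3 / 2) : ℝ)) =
      ENNReal.ofReal (2 * s ^ (-(1 / 2) : ℝ)) := by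
  have hi : IntegrableOn (fun s : ℝ => s ^ (-(3 / 2) : ℝ)) (Ioi s) :=
    integrableOn_Ioi_rpow_of_lt (by norm_num) hs
  rw [← ofReal_integral_eq_lintegral_ofReal hi
    ((ae_restrict_mem measurableSet_Ioi).mono fun h hh => Real.rpow_nonneg (hs.trans hh).le _),
    integral_Ioi_rpow_of_lt (by norm_num) hs]
  congr 1
  norm_num
  ring

/-- Weighted Cauchy-Schwarz inequality underlying Hardy's inequality. -/
theorem sq_setLIntegral_Ioo_le {G : ℝ → ℝ≥0∞} (hG : Measurable G) {h : ℝ} (hh : 0 < h) :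
    (∫⁻ s in Ioo 0 h, G s) ^ 2 ≤ ENNReal.ofReal (2 * h ^ (1 / 2 : ℝ)) *
      ∫⁻ s in Ioo 0 h, ENNReal.ofReal (s ^ (1 / 2 : ℝ)) * G s ^ 2 := by
  have h1 : ∫⁻ s in Ioo 0 h, G s = ∫⁻ s in Ioo 0 h, ENNReal.ofReal (s ^ (-(1 / 4) : ℝ)) *
      (ENNReal.ofReal (s ^ (1 / 4 : ℝ)) * G s) := by
    refine setLIntegral_congr_fun measurableSet_Ioo fun s hs => ?_
    rw [← mul_assoc, ← ENNReal.ofReal_mul (Real.rpow_nonneg hs.1.le _), ← Real.rpow_add hs.1]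
    norm_num
  rw [h1]
  refine (sq_lintegral_mul_le (by fun_prop) (by fun_prop)).trans_eq ?_
  rw [← lintegral_Ioo_rpow_neg_half hh]
  congr 1
  · refine setLIntegral_congr_fun measurableSet_Ioo fun s hs => ?_
    rw [← ENNReal.ofReal_pow (Real.rpow_nonneg hs.1.le _), ← Real.rpow_natCast,
      ← Real.rpow_mul hs.1.le]
    norm_num
  · refine setLIntegral_congr_fun measurableSet_Ioo fun s hs => ?_
    rw [mul_pow, ← ENNReal.ofReal_pow (Real.rpow_nonneg hs.1.le _), ← Real.rpow_natCast,
      ← Real.rpow_mul hs.1.le]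
    norm_num

/-- Hardy's inequality in `L²(0, ∞)`. -/
theorem lintegral_hardy_le {G : ℝ → ℝ≥0∞} (hG : Measurable G) :
    ∫⁻ h in Ioi (0 : ℝ), ENNReal.ofReal (1 / h ^ 2) * (∫⁻ s in Ioo 0 h, G s) ^ 2 ≤
      4 * ∫⁻ s in Ioi (0 : ℝ), G s ^ 2 := by
  let K : ℝ → ℝ → ℝ≥0∞ := fun h s => {p : ℝ × ℝ | p.2 < p.1}.indicator
    (fun p => ENNReal.ofReal (2 * p.1 ^ (-(3 / 2) : ℝ)) *
      (ENNReal.ofReal (p.2 ^ (1 / 2 : ℝ)) * G p.2 ^ 2)) (h, s)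
  have hK : Measurable (Function.uncurry K) :=
    Measurable.indicator (by fun_prop) (measurableSet_lt measurable_snd measurable_fst)
  calc
    _ ≤ ∫⁻ h in Ioi (0 : ℝ), ∫⁻ s in Ioi (0 : ℝ), K h s := by
      refine setLIntegral_mono' measurableSet_Ioi fun h (hh : 0 < h) => ?_
      refine (mul_le_mul_right (sq_setLIntegral_Ioo_le hG hh) _).trans_eq ?_
      have hK' : ∀ s, K h s = (Iio h).indicator
          (fun s => ENNReal.ofReal (2 * h ^ (-(3 / 2) : ℝ)) *
            (ENNReal.ofReal (s ^ (1 / 2 : ℝ)) * G s ^ 2)) s := fun s => by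
        simp [K, indicator]
      simp_rw [hK']
      rw [setLIntegral_indicator measurableSet_Iio, Iio_inter_Ioi,
        lintegral_const_mul _ (by fun_prop), ← mul_assoc, ← ENNReal.ofReal_mul (by positivity)]
      congr 2
      have : h ^ (-(3 / 2) : ℝ) = h ^ (1 / 2 : ℝ) / h ^ 2 := by
        rw [← Real.rpow_natCast, ← Real.rpow_sub hh]; norm_num
      rw [this]; ring
    _ = ∫⁻ s in Ioi (0 : ℝ), ∫⁻ h in Ioi (0 : ℝ), K h s :=
      lintegral_lintegral_swap hK.aemeasurable
    _ = ∫⁻ s in Ioi (0 : ℝ), 4 * G s ^ 2 := by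
      refine setLIntegral_congr_fun measurableSet_Ioi fun s (hs : 0 < s) => ?_
      have hK' : ∀ h, K h s = (Ioi s).indicator
          (fun h => (2 * (ENNReal.ofReal (s ^ (1 / 2 : ℝ)) * G s ^ 2)) *
            ENNReal.ofReal (h ^ (-(3 / 2) : ℝ))) h := fun h => by
        simp only [K, indicator, mem_ofPred_eq, mem_Ioi]
        split_ifs
        · rw [ENNReal.ofReal_mul (by norm_num)]
          simp only [ENNReal.ofReal_ofNat]
          ring
        · rfl
      simp_rw [hK']
      rw [setLIntegral_indicator measurableSet_Ioi, inter_eq_left.2 (Ioi_subset_Ioi hs.le),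
        lintegral_const_mul _ (by fun_prop), lintegral_Ioi_rpow_neg_three_halves hs]
      have h1 : ENNReal.ofReal (s ^ (1 / 2 : ℝ)) * ENNReal.ofReal (2 * s ^ (-(1 / 2) : ℝ)) = 2 := by
        rw [← ENNReal.ofReal_mul (by positivity), mul_left_comm, ← Real.rpow_add hs]
        norm_num
      calc _ = 2 * G s ^ 2 * (ENNReal.ofReal (s ^ (1 / 2 : ℝ)) *
            ENNReal.ofReal (2 * s ^ (-(1 / 2) : ℝ))) := by ring
        _ = _ := by rw [h1]; ring
    _ = _ := lintegral_const_mul _ (by fun_prop)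

theorem lintegral_comp_mul_left {f : ℝ → ℝ≥0∞} (hf : Measurable f) {c : ℝ} (hc : c ≠ 0) :
    ∫⁻ s, f (c * s) = ENNReal.ofReal |c⁻¹| * ∫⁻ s, f s := by
  rw [← lintegral_map hf (measurable_const_mul c), Real.map_volume_mul_left hc,
    lintegral_smul_measure, smul_eq_mul]

/-- Change of variables `(y, s) ↦ (y + v.1 * s, v.2 * s)`. -/
theorem lintegral_lintegral_comp_shear {f : ℝ × ℝ → ℝ≥0∞} (hf : Measurable f) {v : ℝ × ℝ}
    (hv : v.2 ≠ 0) :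
    ∫⁻ y, ∫⁻ s, f (y + v.1 * s, v.2 * s) = ENNReal.ofReal |v.2⁻¹| * ∫⁻ p, f p := by
  rw [lintegral_lintegral_swap (Measurable.aemeasurable (by unfold Function.uncurry; fun_prop))]
  simp_rw [fun s => lintegral_add_right_eq_self (μ := (volume : Measure ℝ))
    (fun y => f (y, v.2 * s)) (v.1 * s)]
  rw [lintegral_comp_mul_left (f := fun s => ∫⁻ y, f (y, s)) hf.lintegral_prod_left' hv,
    Measure.volume_eq_prod, lintegral_prod_symm' _ hf]

/-- The increment of a `C¹` function along a segment is bounded by the integral of the norm of its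
derivative. -/
theorem enorm_sub_le_lintegral_fderiv {U : Set (ℝ × ℝ)} (hU : IsOpen U) {φ : ℝ × ℝ → ℝ}
    (hφ : ContDiffOn ℝ 1 φ U) {p v : ℝ × ℝ} (hv : ‖v‖ ≤ 1) {h : ℝ} (hh : 0 < h)
    (hp : ∀ s ∈ Icc 0 h, p + s • v ∈ U) :
    ‖φ (p + h • v) - φ p‖ₑ ≤
      ∫⁻ s in Ioo 0 h, U.indicator (fun q => ‖fderiv ℝ φ q‖ₑ) (p + s • v) := by
  have hc : ContinuousOn (fun s : ℝ => fderiv ℝ φ (p + s • v) v) (Icc 0 h) :=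
    ((hφ.continuousOn_fderiv_of_isOpen hU le_rfl).comp (by fun_prop) hp).clm_apply
      continuousOn_const
  have hd : ∀ s ∈ uIcc 0 h, HasDerivAt (fun s : ℝ => φ (p + s • v))
      (fderiv ℝ φ (p + s • v) v) s := fun s hs => by
    rw [uIcc_of_le hh.le] at hs
    have h1 : HasDerivAt (fun s : ℝ => p + s • v) v s := by
      simpa using ((hasDerivAt_id s).smul_const v).const_add p
    exact (((hφ.contDiffAt (hU.mem_nhds (hp s hs))).differentiableAt
      one_ne_zero).hasFDerivAt).comp_hasDerivAt s h1
  have hi := intervalIntegral.integral_eq_sub_of_hasDerivAt hd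
    ((uIcc_of_le hh.le).symm ▸ hc).intervalIntegrable
  rw [zero_smul, add_zero] at hi
  rw [← hi, intervalIntegral.integral_of_le hh.le, ← restrict_Ioo_eq_restrict_Ioc]
  refine (enorm_integral_le_lintegral_enorm _).trans ?_
  refine setLIntegral_mono' measurableSet_Ioo fun s hs => ?_
  rw [indicator_of_mem (hp s ⟨hs.1.le, hs.2.le⟩), enorm_le_iff_norm_le]
  exact (ContinuousLinearMap.le_opNorm _ _).trans (mul_le_of_le_one_right (norm_nonneg _) hv)

/-- The square of the mean value of `f` along the segment from `(y, 0)` to `(y, 0) + h • v`. -/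
noncomputable def sqSegmentMean (f : ℝ × ℝ → ℝ≥0∞) (v : ℝ × ℝ) (y h : ℝ) : ℝ≥0∞ :=
  ENNReal.ofReal (1 / h ^ 2) * (∫⁻ s in Ioo 0 h, f ((y, 0) + s • v)) ^ 2

theorem measurable_sqSegmentMean {f : ℝ × ℝ → ℝ≥0∞} (hf : Measurable f) (v : ℝ × ℝ) :
    Measurable fun p : ℝ × ℝ => sqSegmentMean f v p.1 p.2 := by
  refine Measurable.mul (by fun_prop) (Measurable.pow_const ?_ 2)
  have h1 : Measurable fun q : (ℝ × ℝ) × ℝ =>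
      {q : (ℝ × ℝ) × ℝ | 0 < q.2 ∧ q.2 < q.1.2}.indicator
        (fun q => f ((q.1.1, 0) + q.2 • v)) q := by
    refine Measurable.indicator (by fun_prop) ?_
    exact (measurableSet_lt measurable_const measurable_snd).inter
      (measurableSet_lt measurable_snd (by fun_prop))
  convert h1.lintegral_prod_right' (ν := volume) using 2 with p
  rw [← lintegral_indicator measurableSet_Ioo]
  rfl

theorem lintegral_sqSegmentMean_le {f : ℝ × ℝ → ℝ≥0∞} (hf : Measurable f) {v : ℝ × ℝ}
    (hv : v.2 ≠ 0) :
    ∫⁻ y, ∫⁻ h in Ioi 0, sqSegmentMean f v y h ≤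
      4 * (ENNReal.ofReal |v.2⁻¹| * ∫⁻ p, f p ^ 2) := by
  rw [← lintegral_lintegral_comp_shear (hf.pow_const 2) hv,
    ← lintegral_const_mul _ (Measurable.lintegral_prod_right' (f := fun p : ℝ × ℝ =>
      f (p.1 + v.1 * p.2, v.2 * p.2) ^ 2) (by fun_prop))]
  refine lintegral_mono fun y => ?_
  refine (lintegral_hardy_le (G := fun s => f ((y, 0) + s • v)) (by fun_prop)).trans ?_
  refine mul_le_mul_right ((setLIntegral_le_lintegral _ _).trans_eq ?_) _
  refine lintegral_congr fun s => ?_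
  congr 2
  ext <;> simp [mul_comm]

theorem lintegral_sqSegmentMean_add_le {f : ℝ × ℝ → ℝ≥0∞} (hf : Measurable f) {v : ℝ × ℝ}
    (hv : v.2 ≠ 0) :
    ∫⁻ x, ∫⁻ h in Ioi 0, sqSegmentMean f v (x + h) h ≤
      4 * (ENNReal.ofReal |v.2⁻¹| * ∫⁻ p, f p ^ 2) := by
  have hm := measurable_sqSegmentMean hf v
  refine le_trans (le_of_eq ?_) (lintegral_sqSegmentMean_le hf hv)
  rw [lintegral_lintegral_swap, lintegral_lintegral_swap (f := sqSegmentMean f v) hm.aemeasurable]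
  · exact lintegral_congr fun h =>
      lintegral_add_right_eq_self (fun y => sqSegmentMean f v y h) h
  · exact (hm.comp (g := fun p : ℝ × ℝ => sqSegmentMean f v p.1 p.2)
      (f := fun p : ℝ × ℝ => (p.1 + p.2, p.2)) (by fun_prop)).aemeasurable

theorem ofReal_sq_sub_div_le {U : Set (ℝ × ℝ)} (hU : IsOpen U) {φ : ℝ × ℝ → ℝ}
    (hφ : ContDiffOn ℝ 1 φ U) {v w : ℝ × ℝ} (hv : ‖v‖ ≤ 1) (hw : ‖w‖ ≤ 1)
    (hvw : v = (1, 0) + w) {x h : ℝ} (hh : 0 < h)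
    (hT : convexHull ℝ {(x, 0), (x + h, 0), (x, 0) + h • v} ⊆ U) :
    ENNReal.ofReal ((φ (x + h, 0) - φ (x, 0)) ^ 2 / h ^ 2) ≤
      2 * (sqSegmentMean (U.indicator fun q => ‖fderiv ℝ φ q‖ₑ) v x h +
        sqSegmentMean (U.indicator fun q => ‖fderiv ℝ φ q‖ₑ) w (x + h) h) := by
  have hseg : ∀ {p u : ℝ × ℝ}, segment ℝ p (p + h • u) ⊆ U → ∀ s ∈ Icc 0 h, p + s • u ∈ U := by
    intro p u hp s hs
    refine hp ?_
    rw [segment_eq_image']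
    refine ⟨s / h, ⟨div_nonneg hs.1 hh.le, (div_le_one hh).2 hs.2⟩, ?_⟩
    simp [smul_smul, div_mul_cancel₀ _ hh.ne']
  have hend : ((x + h, 0) : ℝ × ℝ) + h • w = (x, 0) + h • v := by
    rw [hvw]; ext <;> simp; ring
  have h1 := enorm_sub_le_lintegral_fderiv hU hφ hv hh (p := (x, 0))
    (hseg ((segment_subset_convexHull (by simp) (by simp)).trans hT))
  have h2 := enorm_sub_le_lintegral_fderiv hU hφ hw hh (p := (x + h, 0))
    (hseg ((segment_subset_convexHull (by simp) (by rw [hend]; simp)).trans hT))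
  rw [hend] at h2
  have h3 : ‖φ (x + h, 0) - φ (x, 0)‖ₑ ≤ ‖φ ((x, 0) + h • v) - φ (x, 0)‖ₑ +
      ‖φ ((x, 0) + h • v) - φ (x + h, 0)‖ₑ := by
    rw [← sub_sub_sub_cancel_left (φ (x, 0)) (φ (x + h, 0)) (φ ((x, 0) + h • v))]
    exact enorm_sub_le
  have h4 := ENNReal.rpow_add_le_mul_rpow_add_rpow (∫⁻ s in Ioo 0 h,
    U.indicator (fun q => ‖fderiv ℝ φ q‖ₑ) ((x, 0) + s • v)) (∫⁻ s in Ioo 0 h,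
    U.indicator (fun q => ‖fderiv ℝ φ q‖ₑ) ((x + h, 0) + s • w)) (p := 2) (by norm_num)
  norm_num at h4
  calc _ = ENNReal.ofReal (1 / h ^ 2) * ‖φ (x + h, 0) - φ (x, 0)‖ₑ ^ 2 := by
        rw [Real.enorm_eq_ofReal_abs, ← ENNReal.ofReal_pow (abs_nonneg _), sq_abs,
          ← ENNReal.ofReal_mul (by positivity), one_div_mul_eq_div]
    _ ≤ _ := mul_le_mul_right ((pow_le_pow_left' (h3.trans (add_le_add h1 h2)) 2).trans h4) _
    _ = _ := by unfold sqSegmentMean; ring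

/-- The trace estimate for triangles with apex `(x + c1 * h, -d * h)` over the base
`[x, x + h] × {0}`. -/
theorem lintegral_trace_le {c1 d : ℝ} (hc1_pos : 0 < c1) (hc1_le : c1 ≤ 1) (hd_pos : 0 < d)
    (hd_le : d ≤ 1) {E : Set ℝ} (hE : MeasurableSet E) {Hplus : ℝ → Set ℝ}
    (hH : ∀ x, ∃ r, Hplus x = Ioo 0 r) {U : Set (ℝ × ℝ)} (hU : IsOpen U)
    (hT : ∀ x ∈ E, ∀ h ∈ Hplus x,
      convexHull ℝ {(x, 0), (x + h, 0), (x + c1 * h, -d * h)} ⊆ U)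
    {φ : ℝ × ℝ → ℝ} (hφ : ContDiffOn ℝ 1 φ U) :
    ∫⁻ x in E, ∫⁻ h in Hplus x, ENNReal.ofReal ((φ (x + h, 0) - φ (x, 0)) ^ 2 / h ^ 2) ≤
      ENNReal.ofReal (16 * d⁻¹) * ∫⁻ p in U, ENNReal.ofReal (‖fderiv ℝ φ p‖ ^ 2) := by
  set g := U.indicator fun q => ‖fderiv ℝ φ q‖ₑ with hg_def
  have hg : Measurable g := (measurable_fderiv ℝ φ).enorm.indicator hU.measurableSet
  have hg2 : ∫⁻ p, g p ^ 2 = ∫⁻ p in U, ENNReal.ofReal (‖fderiv ℝ φ p‖ ^ 2) := by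
    rw [← lintegral_indicator hU.measurableSet]
    refine lintegral_congr fun p => ?_
    by_cases hp : p ∈ U <;> simp [hg_def, hp, ENNReal.ofReal_pow]
  let v : ℝ × ℝ := (c1, -d)
  let w : ℝ × ℝ := (c1 - 1, -d)
  have hv : ‖v‖ ≤ 1 := by
    simp only [v, Prod.norm_def, Real.norm_eq_abs, abs_neg, sup_le_iff, abs_le]
    constructor <;> constructor <;> linarith
  have hw : ‖w‖ ≤ 1 := by
    simp only [w, Prod.norm_def, Real.norm_eq_abs, abs_neg, sup_le_iff, abs_le]
    constructor <;> constructor <;> linarith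
  have hvw : v = (1, 0) + w := by ext <;> simp [v, w]
  have hm : Measurable (Function.uncurry (sqSegmentMean g v)) := measurable_sqSegmentMean hg v
  have hmx : ∀ x, Measurable (sqSegmentMean g v x) := fun x => hm.of_uncurry_left
  have hmi : Measurable fun x => ∫⁻ h in Ioi 0, sqSegmentMean g v x h := hm.lintegral_prod_right'
  calc
    _ ≤ ∫⁻ x in E, ∫⁻ h in Hplus x,
        2 * (sqSegmentMean g v x h + sqSegmentMean g w (x + h) h) := by
      refine setLIntegral_mono' hE fun x hx => ?_
      obtain ⟨r, hr⟩ := hH x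
      refine setLIntegral_mono' (hr ▸ measurableSet_Ioo) fun h hh => ?_
      refine ofReal_sq_sub_div_le hU hφ hv hw hvw (hr ▸ hh : h ∈ Ioo 0 r).1 ?_
      convert hT x hx h hh using 5
      ext <;> simp [v, mul_comm]
    _ ≤ ∫⁻ x, ∫⁻ h in Ioi 0,
        2 * (sqSegmentMean g v x h + sqSegmentMean g w (x + h) h) := by
      refine (setLIntegral_le_lintegral _ _).trans (lintegral_mono fun x => ?_)
      obtain ⟨r, hr⟩ := hH x
      exact lintegral_mono_set (hr ▸ Ioo_subset_Ioi_self)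
    _ = 2 * ((∫⁻ x, ∫⁻ h in Ioi 0, sqSegmentMean g v x h) +
        ∫⁻ x, ∫⁻ h in Ioi 0, sqSegmentMean g w (x + h) h) := by
      rw [← lintegral_add_left hmi,
        ← lintegral_const_mul' _ _ ENNReal.ofNat_ne_top]
      refine lintegral_congr fun x => ?_
      rw [lintegral_const_mul' _ _ ENNReal.ofNat_ne_top, lintegral_add_left (hmx x)]
    _ ≤ 2 * (4 * (ENNReal.ofReal |v.2⁻¹| * ∫⁻ p, g p ^ 2) +
        4 * (ENNReal.ofReal |w.2⁻¹| * ∫⁻ p, g p ^ 2)) := by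
      gcongr
      · exact lintegral_sqSegmentMean_le hg (neg_ne_zero.2 hd_pos.ne')
      · exact lintegral_sqSegmentMean_add_le hg (neg_ne_zero.2 hd_pos.ne')
    _ = _ := by
      have habs : |(-d)⁻¹| = d⁻¹ := by rw [inv_neg, abs_neg, abs_of_pos (inv_pos.2 hd_pos)]
      rw [hg2, ENNReal.ofReal_mul (by norm_num), ENNReal.ofReal_ofNat]
      simp only [v, w, habs]
      ring

/-- the key trace estimate. Given `c0 > 0` and `c1 := c0²/(1 + c0²)`,
there is `C > 0` depending only on `c0` such that whenever `E = (a, b)` (with `b` real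
or `+∞`), `H⁺(x) = (0, min(ρ0, b − x))` (resp. `(0, ρ0)`), and `U ⊆ ℝ²` is an open set
containing, for every `x ∈ E` and `h ∈ H⁺(x)`, the closed triangle with vertices
`(x, 0)`, `(x + h, 0)`, `(x + c1 h, −(c1/c0) h)`, every `C¹` function `φ` on `U` with
finite Dirichlet energy satisfies
`∫_E ∫_{H⁺(x)} (φ(x+h,0) − φ(x,0))²/h² dh dx ≤ C ∫_U |∇φ|²`. -/
theorem statement8 (c0 : ℝ) (hc0 : 0 < c0) :
    ∃ C : ℝ, 0 < C ∧
      ∀ (a ρ0 : ℝ), 0 < ρ0 →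
      ∀ (E : Set ℝ) (Hplus : ℝ → Set ℝ),
        ((∃ b : ℝ, a < b ∧ E = Set.Ioo a b ∧
            ∀ x, Hplus x = Set.Ioo 0 (min ρ0 (b - x))) ∨
          (E = Set.Ioi a ∧ ∀ x, Hplus x = Set.Ioo 0 ρ0)) →
      ∀ U : Set (ℝ × ℝ), IsOpen U →
        (∀ x ∈ E, ∀ h ∈ Hplus x,
          convexHull ℝ {((x : ℝ), (0 : ℝ)), (x + h, 0),
            (x + c0 ^ 2 / (1 + c0 ^ 2) * h, -(c0 ^ 2 / (1 + c0 ^ 2) / c0) * h)} ⊆ U) →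
      ∀ φ : ℝ × ℝ → ℝ, ContDiffOn ℝ 1 φ U →
        (∫⁻ p in U, ENNReal.ofReal (‖fderiv ℝ φ p‖ ^ 2)) < ⊤ →
        ∫⁻ x in E, ∫⁻ h in Hplus x,
            ENNReal.ofReal ((φ (x + h, 0) - φ (x, 0)) ^ 2 / h ^ 2) ≤
          ENNReal.ofReal C * ∫⁻ p in U, ENNReal.ofReal (‖fderiv ℝ φ p‖ ^ 2) := by
  have hc1_le : c0 ^ 2 / (1 + c0 ^ 2) ≤ 1 := by
    rw [div_le_one (by positivity)]
    linarith
  have hd_le : c0 ^ 2 / (1 + c0 ^ 2) / c0 ≤ 1 := by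
    rw [div_div, div_le_one (by positivity)]
    nlinarith [mul_nonneg hc0.le (sq_nonneg (c0 - 1)), pow_pos hc0 3]
  refine ⟨16 * (c0 ^ 2 / (1 + c0 ^ 2) / c0)⁻¹, by positivity, ?_⟩
  intro a ρ0 _ E Hplus hEH U hU hT φ hφ _
  have hE : MeasurableSet E := by
    rcases hEH with ⟨b, _, rfl, _⟩ | ⟨rfl, _⟩
    exacts [measurableSet_Ioo, measurableSet_Ioi]
  have hH : ∀ x, ∃ r, Hplus x = Ioo 0 r := by
    rcases hEH with ⟨b, _, _, h⟩ | ⟨_, h⟩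
    exacts [fun x => ⟨_, h x⟩, fun x => ⟨_, h x⟩]
  exact lintegral_trace_le (by positivity) hc1_le (by positivity) hd_le hE hH hU hT hφ
end

section
/- Let ξ₁ < ξ₂ be real numbers, let h_m > 0 and ξ_m ∈ (ξ₁, ξ₂) satisfy (ξ_m − ξ₁)(ξ₂ − ξ_m) = h_m² (so that the two segments below meet at a right angle), and let ℓ > 0. Let U ⊆ ℝ² be an open set containing, for every l ∈ [0, ℓ], the closed segment joining (ξ₁ + l, 0) to (ξ_m + l, −h_m) and the closed segment joining (ξ_m + l, −h_m) to (ξ₂ + l, 0). Then there exists a constant C > 0, depending only on ξ₁, ξ₂, ξ_m, h_m and ℓ, such that every function φ that is continuously differentiable on U with ∫_U |∇φ|² < ∞ satisfies | (1/ℓ) ∫₀^ℓ φ(ξ₂ + l, 0) dl − (1/ℓ) ∫₀^ℓ φ(ξ₁ + l, 0) dl | ≤ C ( ∫_U |∇φ|² )^{1/2}. -/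
open MeasureTheory Set Filter
open scoped ENNReal BigOperators

/-- The integral of a nonnegative function over the parallelogram swept by the horizontal translates
of a slanted segment, in slanted coordinates, is controlled by its integral over the plane. -/
lemma lintegral_slanted_le (F : ℝ × ℝ → ℝ≥0∞) (hF : Measurable F) (a c y h : ℝ) (hh : h ≠ 0)
    (I J : Set ℝ) :
    ∫⁻ l in I, ∫⁻ t in J, F (a + t * c + l, y + t * h) ≤
      ENNReal.ofReal |h⁻¹| * ∫⁻ p, F p := by
  have hG : Measurable fun s : ℝ => ∫⁻ x, F (x, s) := hF.lintegral_prod_left'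
  calc ∫⁻ l in I, ∫⁻ t in J, F (a + t * c + l, y + t * h)
      ≤ ∫⁻ l, ∫⁻ t, F (a + t * c + l, y + t * h) :=
        (setLIntegral_le_lintegral _ _).trans
          (lintegral_mono fun _ => setLIntegral_le_lintegral _ _)
    _ = ∫⁻ t, ∫⁻ l, F (a + t * c + l, y + t * h) := by
        refine lintegral_lintegral_swap (Measurable.aemeasurable ?_)
        exact hF.comp (by fun_prop)
    _ = ∫⁻ t, ∫⁻ x, F (x, y + t * h) := by
        refine lintegral_congr fun t => ?_
        exact lintegral_add_left_eq_self (fun x => F (x, y + t * h)) (a + t * c)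
    _ = ∫⁻ s, (∫⁻ x, F (x, y + s)) ∂(Measure.map (· * h) volume) := by
        exact (lintegral_map (hG.comp (measurable_const_add y)) (measurable_mul_const h)).symm
    _ = ENNReal.ofReal |h⁻¹| * ∫⁻ s, ∫⁻ x, F (x, y + s) := by
        rw [Real.map_volume_mul_right hh, lintegral_smul_measure, smul_eq_mul]
    _ = ENNReal.ofReal |h⁻¹| * ∫⁻ p, F p := by
        rw [lintegral_add_left_eq_self (fun s => ∫⁻ x, F (x, s)) y, Measure.volume_eq_prod,
          lintegral_prod_symm _ hF.aemeasurable]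

/-- The increment of a `C¹` function along a segment is bounded by the integral of the norm of its
derivative. -/
lemma enorm_sub_le_lintegral_segment {E : Type*} [NormedAddCommGroup E] [NormedSpace ℝ E]
    {U : Set E} (hU : IsOpen U) {φ : E → ℝ} (hφ : ContDiffOn ℝ 1 φ U) (p v : E)
    (hseg : ∀ t ∈ Icc (0 : ℝ) 1, p + t • v ∈ U) :
    ‖φ (p + v) - φ p‖ₑ ≤ ∫⁻ t in Ioc (0 : ℝ) 1, ‖fderiv ℝ φ (p + t • v)‖ₑ * ‖v‖ₑ := by
  have hcont : ContinuousOn (fun t : ℝ => fderiv ℝ φ (p + t • v) v) (Icc 0 1) := by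
    have h1 : ContinuousOn (fun t : ℝ => fderiv ℝ φ (p + t • v)) (Icc 0 1) :=
      (hφ.continuousOn_fderiv_of_isOpen hU le_rfl).comp (by fun_prop) hseg
    exact h1.clm_apply continuousOn_const
  have hderiv : ∀ t ∈ uIcc (0 : ℝ) 1,
      HasDerivAt (fun t : ℝ => φ (p + t • v)) (fderiv ℝ φ (p + t • v) v) t := by
    intro t ht
    rw [uIcc_of_le zero_le_one] at ht
    have h1 : HasFDerivAt φ (fderiv ℝ φ (p + t • v)) (p + t • v) :=
      ((hφ.differentiableOn one_ne_zero).differentiableAt (hU.mem_nhds (hseg t ht))).hasFDerivAt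
    have h2 : HasDerivAt (fun t : ℝ => p + t • v) v t := by
      simpa using ((hasDerivAt_id t).smul_const v).const_add p
    exact h1.comp_hasDerivAt t h2
  have hftc := intervalIntegral.integral_eq_sub_of_hasDerivAt hderiv
    (ContinuousOn.intervalIntegrable (by rwa [uIcc_of_le zero_le_one]))
  rw [one_smul, zero_smul, add_zero, intervalIntegral.integral_of_le zero_le_one] at hftc
  rw [← hftc]
  exact (enorm_integral_le_lintegral_enorm _).trans
    (lintegral_mono fun t => ContinuousLinearMap.le_opENorm _ _)

/-- The Cauchy–Schwarz inequality for an iterated integral. -/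
lemma sq_lintegral_lintegral_le {α β : Type*} [MeasurableSpace α] [MeasurableSpace β]
    (μ : Measure α) (ν : Measure β) [SFinite μ] [SFinite ν] (f : α → β → ℝ≥0∞)
    (hf : Measurable (Function.uncurry f)) :
    (∫⁻ x, ∫⁻ y, f x y ∂ν ∂μ) ^ 2 ≤ μ univ * ν univ * ∫⁻ x, ∫⁻ y, f x y ^ 2 ∂ν ∂μ := by
  have hprod : ∫⁻ x, ∫⁻ y, f x y ∂ν ∂μ = ∫⁻ z, Function.uncurry f z ∂(μ.prod ν) :=
    (lintegral_prod _ hf.aemeasurable).symm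
  have hprod2 : ∫⁻ x, ∫⁻ y, f x y ^ 2 ∂ν ∂μ = ∫⁻ z, Function.uncurry f z ^ 2 ∂(μ.prod ν) :=
    (lintegral_prod _ (hf.pow_const 2).aemeasurable).symm
  have hCS := ENNReal.lintegral_mul_le_Lp_mul_Lq (μ.prod ν) Real.HolderConjugate.two_two
    (aemeasurable_const (b := (1 : ℝ≥0∞))) hf.aemeasurable
  simp only [Pi.mul_apply, one_mul, one_pow, lintegral_one, ENNReal.rpow_two] at hCS
  rw [hprod, hprod2, ← Measure.prod_prod, univ_prod_univ]
  refine (pow_le_pow_left₀ zero_le hCS 2).trans_eq ?_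
  have hsqrt (x : ℝ≥0∞) : (x ^ (1 / 2 : ℝ)) ^ 2 = x := by
    rw [← ENNReal.rpow_two, ← ENNReal.rpow_mul]
    norm_num
  rw [mul_pow, hsqrt, hsqrt]

/-- The difference of the integrals of a `C¹` function over two horizontal intervals, joined by
translates of a slanted segment, is controlled by the Dirichlet energy. -/
lemma abs_integral_sub_le_sqrt_energy {U : Set (ℝ × ℝ)} (hU : IsOpen U) {φ : ℝ × ℝ → ℝ}
    (hφ : ContDiffOn ℝ 1 φ U)
    (hE : (∫⁻ p in U, ENNReal.ofReal (‖fderiv ℝ φ p‖ ^ 2)) < ⊤)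
    (a b y z ℓ : ℝ) (hyz : z - y ≠ 0) (hℓ : 0 < ℓ)
    (hseg : ∀ l ∈ Icc (0 : ℝ) ℓ, segment ℝ ((a + l, y) : ℝ × ℝ) (b + l, z) ⊆ U) :
    |(∫ l in (0 : ℝ)..ℓ, φ (b + l, z)) - ∫ l in (0 : ℝ)..ℓ, φ (a + l, y)| ≤
      Real.sqrt (ℓ * |(z - y)⁻¹|) * ‖((b - a, z - y) : ℝ × ℝ)‖ *
        Real.sqrt (∫⁻ p in U, ENNReal.ofReal (‖fderiv ℝ φ p‖ ^ 2)).toReal := by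
  set v : ℝ × ℝ := (b - a, z - y) with hv
  set E := ∫⁻ p in U, ENNReal.ofReal (‖fderiv ℝ φ p‖ ^ 2) with hEdef
  have hmem : ∀ l ∈ Icc (0 : ℝ) ℓ, ∀ t ∈ Icc (0 : ℝ) 1, ((a + l, y) : ℝ × ℝ) + t • v ∈ U := by
    intro l hl t ht
    apply hseg l hl
    rw [segment_eq_image']
    exact ⟨t, ht, by simp [hv]⟩
  have hend : ∀ l, ((a + l, y) : ℝ × ℝ) + v = (b + l, z) := fun l => by
    ext <;> simp [hv] ; ring
  have hint : ∀ c w : ℝ, (∀ l ∈ Icc (0 : ℝ) ℓ, ((c + l, w) : ℝ × ℝ) ∈ U) →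
      IntervalIntegrable (fun l => φ (c + l, w)) volume 0 ℓ := fun c w h =>
    ContinuousOn.intervalIntegrable <| by
      rw [uIcc_of_le hℓ.le]
      exact hφ.continuousOn.comp (by fun_prop) h
  have hdiff : (∫ l in (0 : ℝ)..ℓ, φ (b + l, z)) - ∫ l in (0 : ℝ)..ℓ, φ (a + l, y) =
      ∫ l in Ioc 0 ℓ, (φ (b + l, z) - φ (a + l, y)) := by
    rw [← intervalIntegral.integral_sub, intervalIntegral.integral_of_le hℓ.le]
    · exact hint b z fun l hl => hseg l hl (right_mem_segment ..)
    · exact hint a y fun l hl => hseg l hl (left_mem_segment ..)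
  set F : ℝ × ℝ → ℝ≥0∞ := U.indicator fun p => ‖fderiv ℝ φ p‖ₑ with hFdef
  have hF : Measurable F := (measurable_fderiv ℝ φ).enorm.indicator hU.measurableSet
  have hpt : ∀ l t : ℝ, ((a + l, y) : ℝ × ℝ) + t • v = (a + t * (b - a) + l, y + t * (z - y)) := by
    intro l t
    ext <;> simp [hv] ; ring
  have hle : ‖(∫ l in (0 : ℝ)..ℓ, φ (b + l, z)) - ∫ l in (0 : ℝ)..ℓ, φ (a + l, y)‖ₑ ≤
      (∫⁻ l in Ioc 0 ℓ, ∫⁻ t in Ioc (0 : ℝ) 1, F (a + t * (b - a) + l, y + t * (z - y))) *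
        ‖v‖ₑ := by
    rw [hdiff, ← lintegral_mul_const' _ _ enorm_ne_top]
    refine (enorm_integral_le_lintegral_enorm _).trans
      (setLIntegral_mono' measurableSet_Ioc fun l hl => ?_)
    have h := enorm_sub_le_lintegral_segment hU hφ (a + l, y) v (hmem l (Ioc_subset_Icc_self hl))
    rw [hend] at h
    rw [← lintegral_mul_const' _ _ enorm_ne_top]
    refine h.trans (setLIntegral_mono' measurableSet_Ioc fun t ht => ?_)
    rw [← hpt, hFdef,
      indicator_of_mem (hmem l (Ioc_subset_Icc_self hl) t (Ioc_subset_Icc_self ht))]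
  have hEF : ∫⁻ p, F p ^ 2 = E := by
    rw [hEdef, ← lintegral_indicator hU.measurableSet]
    refine lintegral_congr fun p => ?_
    by_cases hp : p ∈ U
    · simp [hFdef, hp, ENNReal.ofReal_pow]
    · simp [hFdef, hp]
  have hsq : (∫⁻ l in Ioc 0 ℓ, ∫⁻ t in Ioc (0 : ℝ) 1,
      F (a + t * (b - a) + l, y + t * (z - y))) ^ 2 ≤
        ENNReal.ofReal ℓ * (ENNReal.ofReal |(z - y)⁻¹| * E) := by
    refine (sq_lintegral_lintegral_le _ _
      (fun l t => F (a + t * (b - a) + l, y + t * (z - y))) (hF.comp (by fun_prop))).trans ?_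
    rw [← hEF]
    simpa using mul_le_mul_right (lintegral_slanted_le (fun p => F p ^ 2) (hF.pow_const 2) a
      (b - a) y (z - y) hyz (Ioc 0 ℓ) (Ioc 0 1)) (ENNReal.ofReal ℓ)
  have hfin : ‖(∫ l in (0 : ℝ)..ℓ, φ (b + l, z)) - ∫ l in (0 : ℝ)..ℓ, φ (a + l, y)‖ₑ ^ 2 ≤
      ENNReal.ofReal ℓ * (ENNReal.ofReal |(z - y)⁻¹| * E) * ‖v‖ₑ ^ 2 := by
    refine (pow_le_pow_left₀ zero_le hle 2).trans ?_
    rw [mul_pow]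
    gcongr
  have htop : ENNReal.ofReal ℓ * (ENNReal.ofReal |(z - y)⁻¹| * E) * ‖v‖ₑ ^ 2 ≠ ⊤ := by
    finiteness
  have hreal := ENNReal.toReal_mono htop hfin
  simp only [ENNReal.toReal_mul, ENNReal.toReal_pow, toReal_enorm, Real.norm_eq_abs,
    ENNReal.toReal_ofReal hℓ.le, ENNReal.toReal_ofReal (abs_nonneg (z - y)⁻¹)] at hreal
  refine abs_le_of_sq_le_sq ?_ (by positivity)
  rw [mul_pow, mul_pow, Real.sq_sqrt (by positivity), Real.sq_sqrt ENNReal.toReal_nonneg]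
  linarith [sq_abs ((∫ l in (0 : ℝ)..ℓ, φ (b + l, z)) - ∫ l in (0 : ℝ)..ℓ, φ (a + l, y))]

/-- control of the difference of two boundary averages of a finite
Dirichlet energy function along an L-shaped broken line. If `ξ₁ < ξ₂`, `h_m > 0`,
`ξ_m ∈ (ξ₁, ξ₂)` with `(ξ_m − ξ₁)(ξ₂ − ξ_m) = h_m²`, `ℓ > 0`, then there is `C > 0`
depending only on these parameters such that for every open `U ⊆ ℝ²` containing the
translated broken lines and every `C¹` function `φ` on `U` with finite Dirichlet energy,
`|(1/ℓ)∫₀^ℓ φ(ξ₂+l, 0) dl − (1/ℓ)∫₀^ℓ φ(ξ₁+l, 0) dl| ≤ C (∫_U |∇φ|²)^{1/2}`. -/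
theorem statement9 (ξ₁ ξ₂ ξm hm ℓ : ℝ) (h12 : ξ₁ < ξ₂) (hhm : 0 < hm)
    (hξm : ξm ∈ Set.Ioo ξ₁ ξ₂) (hright : (ξm - ξ₁) * (ξ₂ - ξm) = hm ^ 2) (hℓ : 0 < ℓ) :
    ∃ C : ℝ, 0 < C ∧
      ∀ U : Set (ℝ × ℝ), IsOpen U →
        (∀ l ∈ Set.Icc (0 : ℝ) ℓ,
          segment ℝ ((ξ₁ + l, 0) : ℝ × ℝ) (ξm + l, -hm) ⊆ U ∧
          segment ℝ ((ξm + l, -hm) : ℝ × ℝ) (ξ₂ + l, 0) ⊆ U) →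
      ∀ φ : ℝ × ℝ → ℝ, ContDiffOn ℝ 1 φ U →
        (∫⁻ p in U, ENNReal.ofReal (‖fderiv ℝ φ p‖ ^ 2)) < ⊤ →
        |(1 / ℓ) * (∫ l in (0 : ℝ)..ℓ, φ (ξ₂ + l, 0)) -
            (1 / ℓ) * (∫ l in (0 : ℝ)..ℓ, φ (ξ₁ + l, 0))| ≤
          C * Real.sqrt (∫⁻ p in U, ENNReal.ofReal (‖fderiv ℝ φ p‖ ^ 2)).toReal := by
  obtain ⟨C₁, hC₁⟩ : ∃ C, C = Real.sqrt (ℓ * |(-hm - 0)⁻¹|) * ‖((ξm - ξ₁, -hm - 0) : ℝ × ℝ)‖ :=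
    ⟨_, rfl⟩
  obtain ⟨C₂, hC₂⟩ : ∃ C, C = Real.sqrt (ℓ * |(0 - -hm)⁻¹|) * ‖((ξ₂ - ξm, 0 - -hm) : ℝ × ℝ)‖ :=
    ⟨_, rfl⟩
  have hC₁0 : 0 ≤ C₁ := by rw [hC₁]; positivity
  have hC₂0 : 0 ≤ C₂ := by rw [hC₂]; positivity
  refine ⟨(1 / ℓ) * (C₁ + C₂ + 1), by positivity, fun U hU hseg φ hφ hE => ?_⟩
  have h₁ := abs_integral_sub_le_sqrt_energy hU hφ hE ξ₁ ξm 0 (-hm) ℓ (by simpa using hhm.ne') hℓ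
    fun l hl => (hseg l hl).1
  have h₂ := abs_integral_sub_le_sqrt_energy hU hφ hE ξm ξ₂ (-hm) 0 ℓ (by simpa using hhm.ne') hℓ
    fun l hl => (hseg l hl).2
  rw [← hC₁] at h₁
  rw [← hC₂] at h₂
  rw [← mul_sub, abs_mul, abs_of_pos (one_div_pos.mpr hℓ), mul_assoc]
  refine mul_le_mul_of_nonneg_left ?_ (by positivity)
  have hS := Real.sqrt_nonneg (∫⁻ p in U, ENNReal.ofReal (‖fderiv ℝ φ p‖ ^ 2)).toReal
  refine (abs_sub_le _ (∫ l in (0 : ℝ)..ℓ, φ (ξm + l, -hm)) _).trans ?_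
  linarith
end

section
/- In the configuration Γ^D, there exists a constant C > 0, depending only on the intervals E_j and windows I_j, such that for every measurable f̃ : ℝ → ℝ, integrable on every bounded measurable subset of ℝ, with |f̃|_{Ḣ^{1/2}(ℝ)} < ∞, the restriction of f̃ to Γ^D satisfies |f̃|_{Ḣ^{1/2}(Γ^D)} ≤ C |f̃|_{Ḣ^{1/2}(ℝ)}. -/
open MeasureTheory Set Filter
open scoped ENNReal BigOperators

/-- The configuration `Γ^D`: `N + 1` nonempty open intervals `E 0, …, E N` listed in
increasing order and separated by gaps of positive length, all bounded except that `E 0`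
may be a half-line unbounded to the left and `E N` a half-line unbounded to the right,
together with bounded averaging windows `I j ⊆ E j` (with `I j = E j` when `E j` is bounded). -/
structure GammaConfig (N : ℕ) where
  hN : 1 ≤ N
  E : Fin (N + 1) → Set ℝ
  I : Fin (N + 1) → Set ℝ
  hE : ∀ j, (∃ a b : ℝ, a < b ∧ E j = Set.Ioo a b) ∨
      (j = 0 ∧ ∃ b : ℝ, E j = Set.Iio b) ∨
      (j = Fin.last N ∧ ∃ a : ℝ, E j = Set.Ioi a)
  hsep : ∀ j : Fin N, ∃ c d : ℝ, c < d ∧ (∀ x ∈ E j.castSucc, x ≤ c) ∧ ∀ y ∈ E j.succ, d ≤ y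
  hIsub : ∀ j, I j ⊆ E j
  hIint : ∀ j, ∃ a b : ℝ, a < b ∧ I j = Set.Ioo a b
  hIeq : ∀ j, Bornology.IsBounded (E j) → I j = E j

/-- The union `Γ^D = ⋃ j, E j`. -/
def GammaConfig.Gamma {N : ℕ} (cfg : GammaConfig N) : Set ℝ := ⋃ j, cfg.E j

/-- The seminorm `|f|_{Ḣ^{1/2}(Γ^D)}`, including the nonlocal terms linking the
connected components. -/
noncomputable def GammaConfig.seminorm {N : ℕ} (cfg : GammaConfig N) (f : ℝ → ℝ) : ℝ≥0∞ :=
  (∑ j : Fin (N + 1), screenedSeminorm (cfg.E j) 1 f) +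
    ∑ j : Fin N, ENNReal.ofReal |avgOn (cfg.I j.succ) f - avgOn (cfg.I j.castSucc) f|

lemma screenedSeminorm_mono_set {I J : Set ℝ} (h : I ⊆ J) (r : ℝ) (f : ℝ → ℝ) :
    screenedSeminorm I r f ≤ screenedSeminorm J r f := by
  unfold screenedSeminorm
  refine ENNReal.rpow_le_rpow ?_ (by norm_num)
  calc
    _ ≤ ∫⁻ x in I, ∫⁻ y in J ∩ Set.Ioo (x - r) (x + r),
          ENNReal.ofReal ((f y - f x) ^ 2 / (y - x) ^ 2) :=
        lintegral_mono fun x => lintegral_mono_set (inter_subset_inter_left _ h)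
    _ ≤ _ := lintegral_mono_set h

lemma screenedSeminorm_sq (I : Set ℝ) (r : ℝ) (f : ℝ → ℝ) :
    ∫⁻ x in I, ∫⁻ y in I ∩ Set.Ioo (x - r) (x + r),
      ENNReal.ofReal ((f y - f x) ^ 2 / (y - x) ^ 2) = screenedSeminorm I r f ^ 2 := by
  unfold screenedSeminorm
  rw [← ENNReal.rpow_natCast, ← ENNReal.rpow_mul]
  norm_num

lemma LocIntOn.integrableOn_Ioo {f : ℝ → ℝ} (hf : LocIntOn univ f) (a b : ℝ) :
    IntegrableOn f (Ioo a b) :=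
  hf _ (subset_univ _) measurableSet_Ioo (Metric.isBounded_Ioo a b)

lemma avgOn_Ioo {a b : ℝ} (h : a < b) (f : ℝ → ℝ) :
    avgOn (Ioo a b) f = (b - a)⁻¹ * ∫ x in Ioo a b, f x := by
  simp [avgOn, h.le]

lemma abs_le_add_inv_mul_sq_div_sq {ε d t : ℝ} (hε : 0 < ε) (hd : d ^ 2 ≤ 1)
    (ht : d = 0 → t = 0) : |t| ≤ ε + ε⁻¹ * (t ^ 2 / d ^ 2) := by
  have h1 : t ^ 2 ≤ t ^ 2 / d ^ 2 := by
    rcases eq_or_ne d 0 with h0 | h0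
    · simp [ht h0]
    · rw [le_div_iff₀ (by positivity)]
      exact mul_le_of_le_one_right (sq_nonneg t) hd
  have h2 : |t| ≤ ε + ε⁻¹ * t ^ 2 := by
    rw [← sq_abs t, inv_mul_eq_div, ← sub_le_iff_le_add', le_div_iff₀ hε]
    nlinarith [sq_nonneg (|t| - ε), abs_nonneg t, sq_nonneg ε]
  have h3 : 0 < ε⁻¹ := inv_pos.2 hε
  nlinarith

lemma abs_integral_integral_sub_le {f : ℝ → ℝ} (hS : screenedSeminorm univ 1 f < ⊤)
    {u a b c d ε : ℝ} (hab : a < b) (hcd : c < d) (ha : u ≤ a) (hb : b ≤ u + 1) (hc : u ≤ c)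
    (hd : d ≤ u + 1) (hε : 0 < ε) :
    |∫ x in Ioo a b, ∫ y in Ioo c d, (f y - f x)| ≤
      ε * ((b - a) * (d - c)) + ε⁻¹ * (screenedSeminorm univ 1 f).toReal ^ 2 := by
  set S := screenedSeminorm univ 1 f with hSdef
  have key : ENNReal.ofReal |∫ x in Ioo a b, ∫ y in Ioo c d, (f y - f x)| ≤
      ENNReal.ofReal (ε * ((b - a) * (d - c)) + ε⁻¹ * S.toReal ^ 2) := by
    rw [← Real.enorm_eq_ofReal_abs]
    calc
      _ ≤ ∫⁻ x in Ioo a b, ∫⁻ y in Ioo c d, ‖f y - f x‖ₑ :=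
          (enorm_integral_le_lintegral_enorm _).trans
            (lintegral_mono fun x => enorm_integral_le_lintegral_enorm _)
      _ ≤ ∫⁻ x in Ioo a b, (ENNReal.ofReal (ε * (d - c)) + ENNReal.ofReal ε⁻¹ *
            ∫⁻ y in univ ∩ Ioo (x - 1) (x + 1),
              ENNReal.ofReal ((f y - f x) ^ 2 / (y - x) ^ 2)) := by
          refine setLIntegral_mono' measurableSet_Ioo fun x hx => ?_
          have hsub : Ioo c d ⊆ univ ∩ Ioo (x - 1) (x + 1) := fun y hy =>
            ⟨mem_univ _, by linarith [hx.1, hx.2, hy.1, hy.2], by linarith [hx.1, hx.2, hy.1, hy.2]⟩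
          calc
            _ ≤ ∫⁻ y in Ioo c d, (ENNReal.ofReal ε + ENNReal.ofReal ε⁻¹ *
                  ENNReal.ofReal ((f y - f x) ^ 2 / (y - x) ^ 2)) := by
                refine setLIntegral_mono' measurableSet_Ioo fun y hy => ?_
                rw [Real.enorm_eq_ofReal_abs, ← ENNReal.ofReal_mul (by positivity),
                  ← ENNReal.ofReal_add hε.le (by positivity)]
                refine ENNReal.ofReal_le_ofReal (abs_le_add_inv_mul_sq_div_sq hε ?_ ?_)
                · have := (hsub hy).2
                  nlinarith [this.1, this.2]
                · intro h
                  rw [sub_eq_zero.1 h, sub_self]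
            _ = ENNReal.ofReal (ε * (d - c)) + ENNReal.ofReal ε⁻¹ *
                  ∫⁻ y in Ioo c d, ENNReal.ofReal ((f y - f x) ^ 2 / (y - x) ^ 2) := by
                rw [lintegral_add_left measurable_const, lintegral_const_mul' _ _ (by simp)]
                simp [ENNReal.ofReal_mul hε.le]
            _ ≤ _ := by
                gcongr
      _ = ENNReal.ofReal (ε * ((b - a) * (d - c))) + ENNReal.ofReal ε⁻¹ *
            ∫⁻ x in Ioo a b, ∫⁻ y in univ ∩ Ioo (x - 1) (x + 1),
              ENNReal.ofReal ((f y - f x) ^ 2 / (y - x) ^ 2) := by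
          rw [lintegral_add_left measurable_const, lintegral_const_mul' _ _ (by simp)]
          simp only [lintegral_const, Measure.restrict_apply_univ, Real.volume_Ioo]
          rw [← ENNReal.ofReal_mul (mul_nonneg hε.le (sub_nonneg.2 hcd.le))]
          ring_nf
      _ ≤ ENNReal.ofReal (ε * ((b - a) * (d - c))) + ENNReal.ofReal ε⁻¹ * S ^ 2 := by
          rw [hSdef, ← screenedSeminorm_sq]
          gcongr
          exact subset_univ _
      _ = _ := by
          have h1 := sub_pos.2 hab
          have h2 := sub_pos.2 hcd
          rw [ENNReal.ofReal_add (by positivity) (by positivity),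
            ENNReal.ofReal_mul (p := ε⁻¹) (by positivity), ENNReal.ofReal_pow (by positivity),
            ENNReal.ofReal_toReal hS.ne]
  refine (ENNReal.ofReal_le_ofReal_iff ?_).1 key
  have h1 := sub_pos.2 hab
  have h2 := sub_pos.2 hcd
  positivity

lemma avgOn_sub_avgOn {f : ℝ → ℝ} (hf : LocIntOn univ f) {a b c d : ℝ} (hab : a < b)
    (hcd : c < d) :
    avgOn (Ioo c d) f - avgOn (Ioo a b) f =
      ((b - a) * (d - c))⁻¹ * ∫ x in Ioo a b, ∫ y in Ioo c d, (f y - f x) := by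
  have h1 := sub_pos.2 hab
  have h2 := sub_pos.2 hcd
  have hin : ∀ x, ∫ y in Ioo c d, (f y - f x) = (∫ y in Ioo c d, f y) - (d - c) * f x := by
    intro x
    rw [integral_sub (hf.integrableOn_Ioo c d) (integrable_const _)]
    simp [hcd.le]
  simp_rw [hin]
  rw [integral_sub (integrable_const _) ((hf.integrableOn_Ioo a b).const_mul _),
    integral_const_mul, avgOn_Ioo hab, avgOn_Ioo hcd]
  simp only [integral_const, measureReal_restrict_apply_univ, Real.volume_real_Ioo_of_le hab.le,
    smul_eq_mul]
  field_simp

/-- The averages over `J` and `K` differ by at most a constant multiple of the screened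
seminorm on `ℝ`. -/
def AvgComparable (J K : Set ℝ) : Prop :=
  ∃ C : ℝ, 0 ≤ C ∧ ∀ f : ℝ → ℝ, LocIntOn univ f → screenedSeminorm univ 1 f < ⊤ →
    |avgOn K f - avgOn J f| ≤ C * (screenedSeminorm univ 1 f).toReal

lemma AvgComparable.symm {J K : Set ℝ} (h : AvgComparable J K) : AvgComparable K J := by
  obtain ⟨C, hC, h⟩ := h
  refine ⟨C, hC, fun f hf hS => ?_⟩
  rw [abs_sub_comm]
  exact h f hf hS

lemma AvgComparable.trans {J K L : Set ℝ} (h₁ : AvgComparable J K) (h₂ : AvgComparable K L) :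
    AvgComparable J L := by
  obtain ⟨C, hC, h⟩ := h₁
  obtain ⟨D, hD, h'⟩ := h₂
  refine ⟨C + D, by positivity, fun f hf hS => ?_⟩
  have := abs_sub_le (avgOn L f) (avgOn K f) (avgOn J f)
  linarith [h f hf hS, h' f hf hS]

lemma AvgComparable.of_length_le_one {u a b c d : ℝ} (hab : a < b) (hcd : c < d) (ha : u ≤ a)
    (hb : b ≤ u + 1) (hc : u ≤ c) (hd : d ≤ u + 1) : AvgComparable (Ioo a b) (Ioo c d) := by
  have hm : 0 < (b - a) * (d - c) := mul_pos (sub_pos.2 hab) (sub_pos.2 hcd)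
  refine ⟨1 + ((b - a) * (d - c))⁻¹, by positivity, fun f hf hS => ?_⟩
  refine le_of_forall_pos_le_add fun δ hδ => ?_
  set s := (screenedSeminorm univ 1 f).toReal with hs
  have hs0 : 0 ≤ s := ENNReal.toReal_nonneg
  have key := abs_integral_integral_sub_le hS hab hcd ha hb hc hd (ε := s + δ) (by positivity)
  rw [avgOn_sub_avgOn hf hab hcd, abs_mul, abs_of_pos (inv_pos.2 hm)]
  have h1 : (s + δ)⁻¹ * s ^ 2 ≤ s := by
    rw [inv_mul_le_iff₀ (by positivity)]
    nlinarith
  calc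
    _ ≤ ((b - a) * (d - c))⁻¹ * ((s + δ) * ((b - a) * (d - c)) + s) := by
        gcongr
        exact key.trans (by gcongr)
    _ = _ := by
        have h2 : (b - a) ≠ 0 := (sub_pos.2 hab).ne'
        have h3 : (d - c) ≠ 0 := (sub_pos.2 hcd).ne'
        field_simp
        ring

lemma AvgComparable.of_split {a m b : ℝ} {R : Set ℝ} (ham : a < m) (hmb : m < b)
    (h₁ : AvgComparable (Ioo a m) R) (h₂ : AvgComparable (Ioo m b) R) :
    AvgComparable (Ioo a b) R := by
  obtain ⟨C, hC, h⟩ := h₁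
  obtain ⟨D, hD, h'⟩ := h₂
  refine ⟨C + D, by positivity, fun f hf hS => ?_⟩
  have hsplit : ∫ x in Ioo a b, f x = (∫ x in Ioo a m, f x) + ∫ x in Ioo m b, f x := by
    have hi : ∀ p q, p < q → IntervalIntegrable f volume p q := fun p q hpq => by
      rw [intervalIntegrable_iff_integrableOn_Ioo_of_le hpq.le]
      exact hf.integrableOn_Ioo p q
    simp_rw [← integral_Ioc_eq_integral_Ioo]
    rw [← intervalIntegral.integral_of_le ham.le, ← intervalIntegral.integral_of_le hmb.le,
      ← intervalIntegral.integral_of_le (ham.trans hmb).le,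
      intervalIntegral.integral_add_adjacent_intervals (hi _ _ ham) (hi _ _ hmb)]
  have p1 := sub_pos.2 ham
  have p2 := sub_pos.2 hmb
  have p3 := sub_pos.2 (ham.trans hmb)
  have hconv : avgOn R f - avgOn (Ioo a b) f =
      (m - a) / (b - a) * (avgOn R f - avgOn (Ioo a m) f) +
        (b - m) / (b - a) * (avgOn R f - avgOn (Ioo m b) f) := by
    rw [avgOn_Ioo ham, avgOn_Ioo hmb, avgOn_Ioo (ham.trans hmb), hsplit]
    field_simp
    ring
  have hw1 : (m - a) / (b - a) ≤ 1 := (div_le_one p3).2 (by linarith)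
  have hw2 : (b - m) / (b - a) ≤ 1 := (div_le_one p3).2 (by linarith)
  rw [hconv, add_mul]
  refine (abs_add_le _ _).trans (add_le_add ?_ ?_)
  · rw [abs_mul, abs_of_pos (div_pos p1 p3)]
    exact (mul_le_of_le_one_left (abs_nonneg _) hw1).trans (h f hf hS)
  · rw [abs_mul, abs_of_pos (div_pos p2 p3)]
    exact (mul_le_of_le_one_left (abs_nonneg _) hw2).trans (h' f hf hS)

lemma AvgComparable.of_length_le_two_pow (n : ℕ) {u a b c d : ℝ} (hab : a < b) (hcd : c < d)
    (ha : u ≤ a) (hb : b ≤ u + 2 ^ n) (hc : u ≤ c) (hd : d ≤ u + 2 ^ n) :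
    AvgComparable (Ioo a b) (Ioo c d) := by
  induction n generalizing u a b c d with
  | zero => exact .of_length_le_one hab hcd ha (by simpa using hb) hc (by simpa using hd)
  | succ n ih =>
    obtain ⟨L, hL⟩ : ∃ L : ℝ, L = 2 ^ n := ⟨_, rfl⟩
    have hL0 : 0 < L := by rw [hL]; positivity
    rw [pow_succ, ← hL] at hb hd
    simp_rw [← hL] at ih
    have left : ∀ p q, p < q → u ≤ p → q ≤ u + L →
        AvgComparable (Ioo p q) (Ioo (u + L / 2) (u + L * 3 / 2)) := fun p q hpq hp hq =>
      (ih (u := u) (c := u + L / 2) (d := u + L) hpq (by linarith) hp hq (by linarith)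
        (by linarith)).trans
      (ih (u := u + L / 2) (by linarith) (by linarith) (by linarith) (by linarith) (by linarith)
        (by linarith))
    have right : ∀ p q, p < q → u + L ≤ p → q ≤ u + L * 2 →
        AvgComparable (Ioo p q) (Ioo (u + L / 2) (u + L * 3 / 2)) := fun p q hpq hp hq =>
      (ih (u := u + L) (c := u + L) (d := u + L * 3 / 2) hpq (by linarith) hp (by linarith)
        (by linarith) (by linarith)).trans
      (ih (u := u + L / 2) (by linarith) (by linarith) (by linarith) (by linarith) (by linarith)
        (by linarith))
    have all : ∀ p q, p < q → u ≤ p → q ≤ u + L * 2 →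
        AvgComparable (Ioo p q) (Ioo (u + L / 2) (u + L * 3 / 2)) := by
      intro p q hpq hp hq
      rcases le_or_gt q (u + L) with h | h
      · exact left p q hpq hp h
      rcases le_or_gt (u + L) p with h' | h'
      · exact right p q hpq h' hq
      exact .of_split h' h (left _ _ h' hp le_rfl) (right _ _ h le_rfl hq)
    exact (all a b hab ha hb).trans (all c d hcd hc hd).symm

lemma avgComparable_Ioo {a b c d : ℝ} (hab : a < b) (hcd : c < d) :
    AvgComparable (Ioo a b) (Ioo c d) := by
  obtain ⟨n, hn⟩ := pow_unbounded_of_one_lt (max b d - min a c) (one_lt_two (α := ℝ))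
  have h1 := le_max_left b d
  have h2 := le_max_right b d
  exact .of_length_le_two_pow n (u := min a c) hab hcd (min_le_left _ _) (by linarith)
    (min_le_right _ _) (by linarith)

/-- restriction to `Γ^D` is bounded: there is `C > 0`, depending only on
the configuration, such that every locally integrable `f̃ : ℝ → ℝ` with
`|f̃|_{Ḣ^{1/2}(ℝ)} < ∞` satisfies `|f̃|_{Ḣ^{1/2}(Γ^D)} ≤ C |f̃|_{Ḣ^{1/2}(ℝ)}`. -/
theorem statement12 {N : ℕ} (cfg : GammaConfig N) :
    ∃ C : ℝ, 0 < C ∧ ∀ ftilde : ℝ → ℝ, LocIntOn Set.univ ftilde →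
      screenedSeminorm Set.univ 1 ftilde < ⊤ →
      cfg.seminorm ftilde ≤ ENNReal.ofReal C * screenedSeminorm Set.univ 1 ftilde := by
  have hcomp : ∀ j : Fin N, AvgComparable (cfg.I j.castSucc) (cfg.I j.succ) := fun j => by
    obtain ⟨a, b, hab, h1⟩ := cfg.hIint j.castSucc
    obtain ⟨c, d, hcd, h2⟩ := cfg.hIint j.succ
    rw [h1, h2]
    exact avgComparable_Ioo hab hcd
  choose C hC hbound using hcomp
  have hsum : 0 ≤ ∑ j, C j := Finset.sum_nonneg fun j _ => hC j
  refine ⟨(N + 1 : ℕ) + ∑ j, C j, by positivity, fun f hf hS => ?_⟩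
  rw [ENNReal.ofReal_add (by positivity) hsum, ENNReal.ofReal_natCast,
    ENNReal.ofReal_sum_of_nonneg fun j _ => hC j, add_mul, Finset.sum_mul]
  refine add_le_add ?_ (Finset.sum_le_sum fun j _ => ?_)
  · refine (Finset.sum_le_card_nsmul _ _ _ fun j _ =>
      screenedSeminorm_mono_set (subset_univ (cfg.E j)) 1 f).trans ?_
    simp
  · refine (ENNReal.ofReal_le_ofReal (hbound j f hf hS)).trans_eq ?_
    rw [ENNReal.ofReal_mul (hC j), ENNReal.ofReal_toReal hS.ne]
end
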